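/- Let n be a positive integer and let α ∈ (1, p(n)). There is a constant C = C(n, α) > 0 with the following property: for every C² function f : (0,∞) → ℝ such that t ↦ t^{−α} f(t) is non-increasing on (0,∞), every x₀ ∈ ℝⁿ, every R > 0, and every positive solution u of Δu + f(u) = 0 on B(x₀, 2R), one has sup_{B(x₀,R)} |∇u|²/u² ≤ C / R². -/

import Mathlib

open Set Metric

/-- Euclidean space ℝⁿ. -/
abbrev E (n : ℕ) := EuclideanSpace ℝ (Fin n)

/-- The Laplacian of `u : ℝⁿ → ℝ`: the sum of its second partial derivatives. -/
noncomputable def lap {n : ℕ} (u : E n → ℝ) (x : E n) : ℝ :=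
  ∑ i : Fin n,
    iteratedFDeriv ℝ 2 u x ![EuclideanSpace.single i 1, EuclideanSpace.single i 1]

open Filter Topology

/-- The `i`-th partial derivative. -/
noncomputable def partialDeriv {n : ℕ} (i : Fin n) (g : E n → ℝ) (x : E n) : ℝ :=
  fderiv ℝ g x (EuclideanSpace.single i 1)

section Calculus

variable {n : ℕ} {g h : E n → ℝ} {x : E n} {i j : Fin n}

lemma ContDiffAt.partialDeriv (hg : ContDiffAt ℝ 2 g x) (i : Fin n) :
    ContDiffAt ℝ 1 (partialDeriv i g) x :=
  (hg.fderiv_right (m := 1) (by norm_num)).clm_apply contDiffAt_const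

lemma ContDiffAt.eventually_differentiableAt {k : WithTop ℕ∞} (hg : ContDiffAt ℝ k g x)
    (hk : 1 ≤ k) : ∀ᶠ y in 𝓝 x, DifferentiableAt ℝ g y :=
  ((hg.of_le hk).eventually (by simp)).mono fun _ hy => hy.differentiableAt (by simp)

lemma Filter.EventuallyEq.partialDeriv (hgh : g =ᶠ[𝓝 x] h) (i : Fin n) :
    partialDeriv i g =ᶠ[𝓝 x] partialDeriv i h := by
  filter_upwards [hgh.fderiv (𝕜 := ℝ)] with y hy
  simp [_root_.partialDeriv, hy]

lemma partialDeriv_partialDeriv (hg : ContDiffAt ℝ 2 g x) (i j : Fin n) :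
    partialDeriv i (partialDeriv j g) x =
      fderiv ℝ (fderiv ℝ g) x (EuclideanSpace.single i 1) (EuclideanSpace.single j 1) := by
  have h1 : DifferentiableAt ℝ (fderiv ℝ g) x :=
    (hg.fderiv_right (m := 1) (by norm_num)).differentiableAt (by simp)
  change fderiv ℝ (fun y => fderiv ℝ g y (EuclideanSpace.single j 1)) x _ = _
  rw [fderiv_clm_apply h1 (differentiableAt_const _)]
  simp

lemma partialDeriv_comm (hg : ContDiffAt ℝ 2 g x) (i j : Fin n) :
    partialDeriv i (partialDeriv j g) x = partialDeriv j (partialDeriv i g) x := by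
  rw [partialDeriv_partialDeriv hg, partialDeriv_partialDeriv hg]
  exact hg.isSymmSndFDerivAt (by simp) _ _

lemma lap_eq_sum (hg : ContDiffAt ℝ 2 g x) :
    lap g x = ∑ i, partialDeriv i (partialDeriv i g) x := by
  simp [lap, iteratedFDeriv_two_apply, partialDeriv_partialDeriv hg]

lemma Filter.EventuallyEq.lap (hgh : g =ᶠ[𝓝 x] h) : lap g =ᶠ[𝓝 x] lap h := by
  filter_upwards [hgh.iteratedFDeriv ℝ 2] with y hy
  simp [_root_.lap, hy]

lemma norm_gradient_sq (g : E n → ℝ) (x : E n) :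
    ‖gradient g x‖ ^ 2 = ∑ i, partialDeriv i g x ^ 2 := by
  rw [EuclideanSpace.real_norm_sq_eq]
  refine Finset.sum_congr rfl fun i _ => ?_
  rw [partialDeriv, ← inner_gradient_left, EuclideanSpace.inner_single_right]
  simp

lemma partialDeriv_mul (hg : DifferentiableAt ℝ g x) (hh : DifferentiableAt ℝ h x)
    (i : Fin n) :
    partialDeriv i (fun y => g y * h y) x = g x * partialDeriv i h x + h x * partialDeriv i g x := by
  simp [partialDeriv, fderiv_fun_mul hg hh]

lemma partialDeriv_add (hg : DifferentiableAt ℝ g x) (hh : DifferentiableAt ℝ h x)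
    (i : Fin n) :
    partialDeriv i (fun y => g y + h y) x = partialDeriv i g x + partialDeriv i h x := by
  simp [partialDeriv, fderiv_fun_add hg hh]

lemma partialDeriv_const_mul (c : ℝ) (hg : DifferentiableAt ℝ g x) (i : Fin n) :
    partialDeriv i (fun y => c * g y) x = c * partialDeriv i g x := by
  simp [partialDeriv, fderiv_const_mul hg]

lemma partialDeriv_sum {ι : Type*} (s : Finset ι) {G : ι → E n → ℝ}
    (hG : ∀ k ∈ s, DifferentiableAt ℝ (G k) x) (i : Fin n) :
    partialDeriv i (fun y => ∑ k ∈ s, G k y) x = ∑ k ∈ s, partialDeriv i (G k) x := by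
  simp [partialDeriv, fderiv_fun_sum hG]

lemma partialDeriv_sq (hg : DifferentiableAt ℝ g x) (i : Fin n) :
    partialDeriv i (fun y => g y ^ 2) x = 2 * g x * partialDeriv i g x := by
  simp only [pow_two]
  rw [partialDeriv_mul hg hg]
  ring

lemma partialDeriv_comp {φ : ℝ → ℝ} {φ' : ℝ} (hφ : HasDerivAt φ φ' (g x))
    (hg : DifferentiableAt ℝ g x) (i : Fin n) :
    partialDeriv i (fun y => φ (g y)) x = φ' * partialDeriv i g x := by
  have := (hφ.comp_hasFDerivAt x hg.hasFDerivAt).fderiv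
  rw [Function.comp_def] at this
  simp [partialDeriv, this]

lemma partialDeriv_comp_add_right (g : E n → ℝ) (a x : E n) (i : Fin n) :
    partialDeriv i (fun y => g (y + a)) x = partialDeriv i g (x + a) := by
  simp [partialDeriv, fderiv_comp_add_right]

lemma lap_add (hg : ContDiffAt ℝ 2 g x) (hh : ContDiffAt ℝ 2 h x) :
    lap (fun y => g y + h y) x = lap g x + lap h x := by
  have := iteratedFDeriv_add_apply (i := 2) (x := x) hg hh
  rw [Pi.add_def] at this
  simp [lap, Finset.sum_add_distrib, this]

lemma lap_const_mul (c : ℝ) (hg : ContDiffAt ℝ 2 g x) :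
    lap (fun y => c * g y) x = c * lap g x := by
  have := iteratedFDeriv_const_smul_apply (i := 2) (x := x) (a := c) hg
  simp only [Pi.smul_def, smul_eq_mul] at this
  simp [lap, this, Finset.mul_sum]

lemma lap_sum {ι : Type*} (s : Finset ι) {G : ι → E n → ℝ}
    (hG : ∀ k ∈ s, ContDiffAt ℝ 2 (G k) x) :
    lap (fun y => ∑ k ∈ s, G k y) x = ∑ k ∈ s, lap (G k) x := by
  classical
  induction s using Finset.induction_on with
  | empty => simp [lap, iteratedFDeriv_two_apply]
  | insert a s ha ih =>
    simp only [Finset.mem_insert, forall_eq_or_imp] at hG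
    simp only [Finset.sum_insert ha]
    rw [lap_add hG.1 (ContDiffAt.sum hG.2), ih hG.2]

lemma lap_comp_add_right (g : E n → ℝ) (a x : E n) :
    lap (fun y => g (y + a)) x = lap g (x + a) := by
  simp [lap, iteratedFDeriv_comp_add_right]

lemma lap_mul (hg : ContDiffAt ℝ 2 g x) (hh : ContDiffAt ℝ 2 h x) :
    lap (fun y => g y * h y) x =
      g x * lap h x + h x * lap g x + 2 * ∑ i, partialDeriv i g x * partialDeriv i h x := by
  rw [lap_eq_sum (hg.mul hh), lap_eq_sum hg, lap_eq_sum hh, Finset.mul_sum, Finset.mul_sum,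
    Finset.mul_sum, ← Finset.sum_add_distrib, ← Finset.sum_add_distrib]
  refine Finset.sum_congr rfl fun i _ => ?_
  have key : partialDeriv i (fun y => g y * h y) =ᶠ[𝓝 x]
      fun y => g y * partialDeriv i h y + h y * partialDeriv i g y := by
    filter_upwards [hg.eventually_differentiableAt (by norm_num),
      hh.eventually_differentiableAt (by norm_num)] with y h1 h2
    exact partialDeriv_mul h1 h2 i
  have dg := hg.differentiableAt (by simp)
  have dh := hh.differentiableAt (by simp)
  have dpg := (hg.partialDeriv i).differentiableAt (by simp)
  have dph := (hh.partialDeriv i).differentiableAt (by simp)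
  rw [(key.partialDeriv i).eq_of_nhds, partialDeriv_add (dg.fun_mul dph) (dh.fun_mul dpg),
    partialDeriv_mul dg dph, partialDeriv_mul dh dpg]
  ring

lemma lap_sq (hg : ContDiffAt ℝ 2 g x) :
    lap (fun y => g y ^ 2) x = 2 * g x * lap g x + 2 * ∑ i, partialDeriv i g x ^ 2 := by
  simp only [pow_two]
  rw [lap_mul hg hg]
  ring

lemma lap_comp {φ φ' : ℝ → ℝ} {φ'' : ℝ} (hφ2 : ContDiffAt ℝ 2 φ (g x))
    (hφ : ∀ᶠ t in 𝓝 (g x), HasDerivAt φ (φ' t) t)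
    (hφ' : HasDerivAt φ' φ'' (g x)) (hg : ContDiffAt ℝ 2 g x) :
    lap (fun y => φ (g y)) x = φ' (g x) * lap g x + φ'' * ∑ i, partialDeriv i g x ^ 2 := by
  rw [lap_eq_sum (g := fun y => φ (g y)) (hφ2.comp x hg), lap_eq_sum hg, Finset.mul_sum, Finset.mul_sum,
    ← Finset.sum_add_distrib]
  refine Finset.sum_congr rfl fun i _ => ?_
  have key : partialDeriv i (fun y => φ (g y)) =ᶠ[𝓝 x]
      fun y => φ' (g y) * partialDeriv i g y := by
    filter_upwards [hg.eventually_differentiableAt (by norm_num),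
      hg.continuousAt.eventually hφ] with y h1 h2
    exact partialDeriv_comp h2 h1 i
  have dg := hg.differentiableAt (by simp)
  have dpg := (hg.partialDeriv i).differentiableAt (by simp)
  rw [(key.partialDeriv i).eq_of_nhds,
    partialDeriv_mul (g := fun y => φ' (g y)) (hφ'.differentiableAt.comp x dg) dpg,
    partialDeriv_comp hφ' dg]
  ring

lemma partialDeriv_eq_zero_of_isLocalMax (hmax : IsLocalMax g x) (i : Fin n) :
    partialDeriv i g x = 0 := by
  simp [partialDeriv, hmax.fderiv_eq_zero]

lemma deriv_deriv_nonpos_of_isLocalMax {φ : ℝ → ℝ} {t : ℝ} (hφ : ContinuousAt φ t)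
    (hmax : IsLocalMax φ t) : deriv (deriv φ) t ≤ 0 := by
  by_contra! hpos
  have hmin := isLocalMin_of_deriv_deriv_pos hpos hmax.deriv_eq_zero hφ
  have hconst : φ =ᶠ[𝓝 t] fun _ => φ t := by
    filter_upwards [hmax, hmin] with s h1 h2 using le_antisymm h1 h2
  have := hconst.deriv.deriv.eq_of_nhds
  simp at this
  exact hpos.ne' this

lemma lap_nonpos_of_isLocalMax (hg : ContDiffAt ℝ 2 g x) (hmax : IsLocalMax g x) :
    lap g x ≤ 0 := by
  rw [lap_eq_sum hg]
  refine Finset.sum_nonpos fun i _ => ?_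
  set e : E n := EuclideanSpace.single i 1 with he
  let l : ℝ → E n := fun t => x + t • e
  have hl : ∀ t, HasDerivAt l e t := fun t => by
    simpa [l] using ((hasDerivAt_id t).smul_const e).const_add x
  have hl0 : l 0 = x := by simp [l]
  have htend : Tendsto l (𝓝 0) (𝓝 x) := by
    have := (hl 0).continuousAt.tendsto
    rwa [hl0] at this
  have hderiv : ∀ {k : E n → ℝ} {t : ℝ}, DifferentiableAt ℝ k (l t) →
      deriv (fun s => k (l s)) t = partialDeriv i k (l t) := fun {k t} hk =>
    (hk.hasFDerivAt.comp_hasDerivAt t (hl t)).deriv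
  have h1 : deriv (fun s => g (l s)) =ᶠ[𝓝 0] fun s => partialDeriv i g (l s) := by
    filter_upwards [htend.eventually (hg.eventually_differentiableAt (by norm_num))] with t ht
    exact hderiv ht
  have h2 := h1.deriv.eq_of_nhds
  rw [hderiv (by rw [hl0]; exact (hg.partialDeriv i).differentiableAt (by simp)), hl0] at h2
  rw [← h2]
  refine deriv_deriv_nonpos_of_isLocalMax ?_ ?_
  · exact ContinuousAt.comp (by rw [hl0]; exact hg.continuousAt) (hl 0).continuousAt
  · have := htend.eventually hmax
    filter_upwards [this] with t ht
    simpa [hl0] using ht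

end Calculus

section DifferenceQuotient

variable {n : ℕ} {g : E n → ℝ} {x : E n} {i j : Fin n}

/-- The difference quotient of `g` with step `t` in the `i`-th coordinate direction. -/
noncomputable def diffQuot (i : Fin n) (g : E n → ℝ) (t : ℝ) (y : E n) : ℝ :=
  t⁻¹ * (g (y + t • EuclideanSpace.single i 1) + (-1) * g y)

lemma tendsto_shift (x : E n) (i : Fin n) :
    Tendsto (fun p : ℝ × E n => p.2 + p.1 • (EuclideanSpace.single i 1 : E n))
      (𝓝[≠] 0 ×ˢ 𝓝 x) (𝓝 x) := by
  have h : Continuous fun p : ℝ × E n => p.2 + p.1 • (EuclideanSpace.single i 1 : E n) := by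
    fun_prop
  have h1 := h.tendsto (0, x)
  simp only [zero_smul, add_zero, nhds_prod_eq] at h1
  exact h1.mono_left (prod_mono_left _ nhdsWithin_le_nhds)

lemma tendsto_diffQuot (hg : ContDiffAt ℝ 1 g x) (i : Fin n) :
    Tendsto (fun p : ℝ × E n => diffQuot i g p.1 p.2) (𝓝[≠] 0 ×ˢ 𝓝 x)
      (𝓝 (partialDeriv i g x)) := by
  set e : E n := EuclideanSpace.single i 1 with he
  have hs := (hg.hasStrictFDerivAt (by simp)).isLittleO
  have ht : Tendsto (fun p : ℝ × E n => (p.2 + p.1 • e, p.2)) (𝓝[≠] 0 ×ˢ 𝓝 x) (𝓝 (x, x)) := by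
    rw [nhds_prod_eq]
    exact (tendsto_shift x i).prodMk tendsto_snd
  have h1 := hs.comp_tendsto ht
  have h2 : (fun p : ℝ × E n => diffQuot i g p.1 p.2 - partialDeriv i g x)
      =o[𝓝[≠] 0 ×ˢ 𝓝 x] fun p => p.1⁻¹ * ‖p.1 • e‖ := by
    refine ((Asymptotics.isBigO_refl (fun p : ℝ × E n => p.1⁻¹) _).mul_isLittleO
      (h1.trans_isBigO (k := fun p : ℝ × E n => ‖p.1 • e‖) ?_)).congr' ?_ EventuallyEq.rfl
    · exact Asymptotics.IsBigO.of_bound 1 (Eventually.of_forall fun p => by simp)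
    · have hne : ∀ᶠ p : ℝ × E n in 𝓝[≠] 0 ×ˢ 𝓝 x, p.1 ≠ 0 :=
        tendsto_fst.eventually self_mem_nhdsWithin
      filter_upwards [hne] with p hp
      simp only [Function.comp_apply, diffQuot, partialDeriv, add_sub_cancel_left, map_smul,
        smul_eq_mul, ← he]
      field_simp
      ring
  have h3 : (fun p : ℝ × E n => p.1⁻¹ * ‖p.1 • e‖) =O[𝓝[≠] 0 ×ˢ 𝓝 x] fun _ => (1 : ℝ) := by
    refine Asymptotics.IsBigO.of_bound 1 (Eventually.of_forall fun p => ?_)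
    rcases eq_or_ne p.1 0 with hp | hp
    · simp [hp]
    · simp [he, norm_smul, hp]
  exact tendsto_sub_nhds_zero_iff.1 ((Asymptotics.isLittleO_one_iff ℝ).1 (h2.trans_isBigO h3))

lemma ContDiffAt.comp_shift {k : WithTop ℕ∞} {a y : E n} (hg : ContDiffAt ℝ k g (y + a)) :
    ContDiffAt ℝ k (fun z => g (z + a)) y :=
  ContDiffAt.comp y hg (contDiffAt_id.add contDiffAt_const)

lemma ContDiffAt.diffQuot {k : WithTop ℕ∞} {t : ℝ} {y : E n} (h1 : ContDiffAt ℝ k g y)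
    (h2 : ContDiffAt ℝ k g (y + t • EuclideanSpace.single i 1)) :
    ContDiffAt ℝ k (diffQuot i g t) y :=
  contDiffAt_const.mul (h2.comp_shift.add (contDiffAt_const.mul h1))

lemma partialDeriv_diffQuot {t : ℝ} {y : E n} (h1 : DifferentiableAt ℝ g y)
    (h2 : DifferentiableAt ℝ g (y + t • EuclideanSpace.single i 1)) :
    partialDeriv j (diffQuot i g t) y = diffQuot i (partialDeriv j g) t y := by
  have h3 : DifferentiableAt ℝ (fun z => g (z + t • EuclideanSpace.single i 1)) y :=
    (differentiableAt_comp_add_right _).2 h2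
  have h4 := h1.const_mul (-1)
  change partialDeriv j (fun z => t⁻¹ *
    (g (z + t • EuclideanSpace.single i 1) + (-1) * g z)) y = _
  rw [partialDeriv_const_mul _ (h3.fun_add h4), partialDeriv_add h3 h4,
    partialDeriv_const_mul _ h1, partialDeriv_comp_add_right]
  rfl

lemma lap_diffQuot {t : ℝ} {y : E n} (h1 : ContDiffAt ℝ 2 g y)
    (h2 : ContDiffAt ℝ 2 g (y + t • EuclideanSpace.single i 1)) :
    lap (diffQuot i g t) y = diffQuot i (lap g) t y := by
  have h4 : ContDiffAt ℝ 2 (fun z => (-1) * g z) y := contDiffAt_const.mul h1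
  change lap (fun z => t⁻¹ * (g (z + t • EuclideanSpace.single i 1) + (-1) * g z)) y = _
  rw [lap_const_mul _ (h2.comp_shift.add h4), lap_add h2.comp_shift h4,
    lap_const_mul _ h1, lap_comp_add_right]
  rfl

end DifferenceQuotient

lemma lap_norm_sub_sq {n : ℕ} (x₀ x : E n) : lap (fun y => ‖y - x₀‖ ^ 2) x = 2 * n := by
  have hc : ∀ (i : Fin n) (y : E n), HasFDerivAt (fun z : E n => z i - x₀ i)
      (EuclideanSpace.proj i : E n →L[ℝ] ℝ) y := fun i y =>
    (EuclideanSpace.proj i : E n →L[ℝ] ℝ).hasFDerivAt.sub_const _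
  have hcd : ∀ i : Fin n, ContDiff ℝ 2 (fun z : E n => z i - x₀ i) := fun i =>
    (EuclideanSpace.proj i : E n →L[ℝ] ℝ).contDiff.sub contDiff_const
  have hl : ∀ i : Fin n, lap (fun z : E n => z i - x₀ i) x = 0 := fun i => by
    have : fderiv ℝ (fun z : E n => z i - x₀ i) =
        fun _ => (EuclideanSpace.proj i : E n →L[ℝ] ℝ) := funext fun y => (hc i y).fderiv
    simp [lap, iteratedFDeriv_two_apply, this]
  have hp : ∀ i j : Fin n, partialDeriv j (fun z : E n => z i - x₀ i) x = if i = j then 1 else 0 :=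
    fun i j => by simp [partialDeriv, (hc i x).fderiv, PiLp.single_apply]
  simp only [EuclideanSpace.real_norm_sq_eq, PiLp.sub_apply]
  rw [lap_sum _ fun i _ => ((hcd i).pow 2).contDiffAt]
  calc _ = ∑ i : Fin n, (2 : ℝ) := Finset.sum_congr rfl fun i _ => by
        rw [lap_sq (hcd i).contDiffAt, hl]
        simp [hp]
    _ = _ := by simp [mul_comm]

lemma partialDeriv_norm_sub_sq {n : ℕ} (x₀ x : E n) (i : Fin n) :
    partialDeriv i (fun y => ‖y - x₀‖ ^ 2) x = 2 * (x i - x₀ i) := by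
  have := ((hasFDerivAt_id x).sub_const x₀).norm_sq.fderiv
  simp only [id] at this
  simp [partialDeriv, this, EuclideanSpace.inner_single_right]

lemma le_zero_of_tendsto_lap {n : ℕ} {ι : Type*} {l : Filter ι} [l.NeBot]
    {Φ : ι → E n → ℝ} {Φ₀ : E n → ℝ} {x : E n} {L : ℝ}
    (hmax : IsLocalMax Φ₀ x)
    (hΦ : ∀ᶠ y in 𝓝 x, Tendsto (fun p : ι × E n => Φ p.1 p.2) (l ×ˢ 𝓝 y) (𝓝 (Φ₀ y)))
    (hcont : ∀ᶠ y in 𝓝 x, ContinuousAt Φ₀ y)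
    (hdiff : ∀ᶠ p : ι × E n in l ×ˢ 𝓝 x, ContDiffAt ℝ 2 (Φ p.1) p.2)
    (hlap : Tendsto (fun p : ι × E n => lap (Φ p.1) p.2) (l ×ˢ 𝓝 x) (𝓝 L)) : L ≤ 0 := by
  suffices h : ∀ δ > 0, L ≤ 2 * n * δ by
    have h0 : Tendsto (fun δ : ℝ => 2 * n * δ) (𝓝[>] 0) (𝓝 0) := by
      have : Continuous fun δ : ℝ => 2 * n * δ := by fun_prop
      simpa using (this.tendsto 0).mono_left nhdsWithin_le_nhds
    exact ge_of_tendsto h0 (eventually_mem_nhdsWithin.mono fun δ hδ => h δ hδ)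
  intro δ hδ
  refine le_of_tendsto_of_frequently hlap fun hev => ?_
  obtain ⟨P, hP, Q, hQ, hPQ⟩ := eventually_prod_iff.1 (hev.and hdiff)
  obtain ⟨r, hr, hball⟩ := nhds_basis_closedBall.eventually_iff.1
    (((hmax.and hΦ).and hcont).and hQ)
  have hunif : TendstoUniformlyOn Φ Φ₀ l (closedBall x r) := by
    rw [← tendstoLocallyUniformlyOn_iff_tendstoUniformlyOn_of_compact (isCompact_closedBall x r),
      tendstoLocallyUniformlyOn_iff_forall_tendsto]
    intro y hy
    have h1 : Tendsto (fun p : ι × E n => (Φ₀ p.2, Φ p.1 p.2)) (l ×ˢ 𝓝 y)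
        (𝓝 (Φ₀ y, Φ₀ y)) :=
      ((hball hy).1.2.tendsto.comp tendsto_snd).prodMk_nhds (hball hy).1.1.2
    exact (h1.mono_left (prod_mono_right _ nhdsWithin_le_nhds)).mono_right
      (nhds_le_uniformity _)
  have hε : 0 < δ * r ^ 2 / 2 := by positivity
  obtain ⟨t, htP, htΦ⟩ := (hP.and (Metric.tendstoUniformlyOn_iff.1 hunif _ hε)).exists
  have hnc : ∀ y, ContDiffAt ℝ 2 (fun y : E n => (-δ) * ‖y - x‖ ^ 2) y := fun y =>
    contDiffAt_const.mul ((contDiffAt_id.sub contDiffAt_const).norm_sq ℝ)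
  let Ψ : E n → ℝ := fun y => Φ t y + (-δ) * ‖y - x‖ ^ 2
  have hΨ : ∀ y ∈ closedBall x r, ContDiffAt ℝ 2 Ψ y := fun y hy =>
    (hPQ htP (hball hy).2).2.add (hnc y)
  obtain ⟨z, hz, hzmax⟩ := (isCompact_closedBall x r).exists_isMaxOn
    ⟨x, mem_closedBall_self hr.le⟩ fun y hy => (hΨ y hy).continuousAt.continuousWithinAt
  have hzint : z ∈ ball x r := by
    rw [mem_closedBall, dist_eq_norm] at hz
    rw [mem_ball, dist_eq_norm]
    refine lt_of_le_of_ne hz fun heq => ?_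
    have hz' : z ∈ closedBall x r := by rw [mem_closedBall, dist_eq_norm]; exact hz
    have h1 : Ψ x ≤ Ψ z := hzmax (mem_closedBall_self hr.le)
    have h2 := abs_lt.1 (htΦ x (mem_closedBall_self hr.le))
    have h3 := abs_lt.1 (htΦ z hz')
    have h4 : Φ₀ z ≤ Φ₀ x := (hball hz').1.1.1
    simp only [Ψ, heq, sub_self, norm_zero] at h1
    linarith [h2.1, h2.2, h3.1, h3.2]
  have hloc : IsLocalMax Ψ z := hzmax.isLocalMax (mem_of_superset (isOpen_ball.mem_nhds hzint)
    ball_subset_closedBall)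
  have hle := lap_nonpos_of_isLocalMax (hΨ z hz) hloc
  have hsq : ContDiffAt ℝ 2 (fun y : E n => ‖y - x‖ ^ 2) z :=
    (contDiffAt_id.sub contDiffAt_const).norm_sq ℝ
  rw [show Ψ = fun y => Φ t y + (-δ) * ‖y - x‖ ^ 2 from rfl,
    lap_add (hPQ htP (hball hz).2).2 (hnc z), lap_const_mul _ hsq, lap_norm_sub_sq] at hle
  exact (hPQ htP (hball hz).2).1 (by simp only; linarith)

/-- Bochner's formula at a maximum of `η |∇v|²`, for `v` which is only `C²` with `Δv` of
class `C¹`; it is obtained by applying the maximum principle to difference quotients of `v`. -/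
lemma bochner_of_isLocalMax {n : ℕ} {v η : E n → ℝ} {x : E n} (hv : ContDiffAt ℝ 2 v x)
    (hlap : ContDiffAt ℝ 1 (lap v) x) (hη : ContDiffAt ℝ 2 η x)
    (hmax : IsLocalMax (fun y => η y * ∑ i, partialDeriv i v y ^ 2) x) :
    η x * ∑ i, (2 * partialDeriv i v x * partialDeriv i (lap v) x
        + 2 * ∑ j, partialDeriv i (partialDeriv j v) x ^ 2)
      + (∑ i, partialDeriv i v x ^ 2) * lap η x
      + 2 * ∑ j, partialDeriv j η x *
        ∑ i, 2 * partialDeriv i v x * partialDeriv i (partialDeriv j v) x ≤ 0 := by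
  have hv1 : ContDiffAt ℝ 1 v x := hv.of_le (by norm_num)
  have hev : ∀ᶠ y in 𝓝 x, ContDiffAt ℝ 2 v y ∧ ContDiffAt ℝ 2 η y :=
    (hv.eventually (by simp)).and (hη.eventually (by simp))
  have hev2 : ∀ᶠ p : ℝ × E n in 𝓝[≠] 0 ×ˢ 𝓝 x,
      ContDiffAt ℝ 2 v p.2 ∧ ContDiffAt ℝ 2 η p.2 ∧
        ∀ i : Fin n, ContDiffAt ℝ 2 v (p.2 + p.1 • EuclideanSpace.single i 1) := by
    filter_upwards [tendsto_snd.eventually hev,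
      eventually_all.2 fun i => (tendsto_shift x i).eventually hev] with p h1 h2
    exact ⟨h1.1, h1.2, fun i => (h2 i).1⟩
  refine le_zero_of_tendsto_lap (l := 𝓝[≠] (0 : ℝ))
    (Φ := fun t y => η y * ∑ i, diffQuot i v t y ^ 2) hmax ?_ ?_ ?_ ?_
  · filter_upwards [hev] with y hy
    exact (hy.2.continuousAt.tendsto.comp tendsto_snd).mul (tendsto_finsetSum _ fun i _ =>
      (tendsto_diffQuot (hy.1.of_le (by norm_num)) i).pow 2)
  · filter_upwards [hev] with y hy
    exact hy.2.continuousAt.mul (tendsto_finsetSum _ fun i _ =>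
      (hy.1.partialDeriv i).continuousAt.tendsto.pow 2)
  · filter_upwards [hev2] with p hp
    exact hp.2.1.mul (ContDiffAt.sum fun i _ => (hp.1.diffQuot (hp.2.2 i)).pow 2)
  have key : ∀ᶠ p : ℝ × E n in 𝓝[≠] 0 ×ˢ 𝓝 x,
      η p.2 * ∑ i, (2 * diffQuot i v p.1 p.2 * diffQuot i (lap v) p.1 p.2
        + 2 * ∑ j, diffQuot i (partialDeriv j v) p.1 p.2 ^ 2)
      + (∑ i, diffQuot i v p.1 p.2 ^ 2) * lap η p.2
      + 2 * ∑ j, partialDeriv j η p.2 *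
        ∑ i, 2 * diffQuot i v p.1 p.2 * diffQuot i (partialDeriv j v) p.1 p.2
      = lap (fun y => η y * ∑ i, diffQuot i v p.1 y ^ 2) p.2 := by
    filter_upwards [hev2] with p hp
    have hd : ∀ i, ContDiffAt ℝ 2 (diffQuot i v p.1) p.2 := fun i => hp.1.diffQuot (hp.2.2 i)
    have hd1 : ∀ i, DifferentiableAt ℝ (diffQuot i v p.1) p.2 := fun i =>
      (hd i).differentiableAt (by simp)
    have hpd : ∀ i j, partialDeriv j (diffQuot i v p.1) p.2
        = diffQuot i (partialDeriv j v) p.1 p.2 := fun i j =>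
      partialDeriv_diffQuot (hp.1.differentiableAt (by simp))
        ((hp.2.2 i).differentiableAt (by simp))
    rw [lap_mul hp.2.1 (ContDiffAt.sum fun i _ => (hd i).pow 2),
      lap_sum _ fun i _ => (hd i).pow 2]
    simp_rw [lap_sq (hd _), lap_diffQuot hp.1 (hp.2.2 _),
      partialDeriv_sum _ fun i _ => (hd1 i).fun_pow 2, partialDeriv_sq (hd1 _), hpd]
  refine Tendsto.congr' key ?_
  have hη' : Tendsto (lap η) (𝓝 x) (𝓝 (lap η x)) := by
    have h1 : (fun y => ∑ i, partialDeriv i (partialDeriv i η) y) =ᶠ[𝓝 x] lap η := by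
      filter_upwards [hev] with y hy using (lap_eq_sum hy.2).symm
    refine Tendsto.congr' h1 ?_
    rw [lap_eq_sum hη]
    refine tendsto_finsetSum _ fun i _ => ?_
    have h2 : ContinuousAt (fun y => fderiv ℝ (partialDeriv i η) y) x :=
      ((hη.partialDeriv i).fderiv_right (m := 0) (by norm_num)).continuousAt
    exact h2.clm_apply continuousAt_const
  have hdv : ∀ i, Tendsto (fun p : ℝ × E n => diffQuot i v p.1 p.2) (𝓝[≠] 0 ×ˢ 𝓝 x)
      (𝓝 (partialDeriv i v x)) := tendsto_diffQuot hv1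
  have hddv : ∀ i j, Tendsto (fun p : ℝ × E n => diffQuot i (partialDeriv j v) p.1 p.2)
      (𝓝[≠] 0 ×ˢ 𝓝 x) (𝓝 (partialDeriv i (partialDeriv j v) x)) := fun i j =>
    tendsto_diffQuot (hv.partialDeriv j) i
  refine (((hη.continuousAt.tendsto.comp tendsto_snd).mul ?_).add
    (Tendsto.mul ?_ (hη'.comp tendsto_snd))).add (Tendsto.const_mul _ ?_)
  · exact tendsto_finsetSum _ fun i _ => (((hdv i).const_mul 2).mul
      (tendsto_diffQuot hlap i)).add
        (Tendsto.const_mul _ (tendsto_finsetSum _ fun j _ => (hddv i j).pow 2))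
  · exact tendsto_finsetSum _ fun i _ => (hdv i).pow 2
  · exact tendsto_finsetSum _ fun j _ =>
      ((hη.partialDeriv j).continuousAt.tendsto.comp tendsto_snd).mul
        (tendsto_finsetSum _ fun i _ => ((hdv i).const_mul 2).mul (hddv i j))

lemma partialDeriv_sum_sq {n : ℕ} {v : E n → ℝ} {x : E n} (hv : ContDiffAt ℝ 2 v x) (i : Fin n) :
    partialDeriv i (fun y => ∑ j, partialDeriv j v y ^ 2) x =
      2 * ∑ j, partialDeriv j v x * partialDeriv i (partialDeriv j v) x := by
  have h : ∀ j, DifferentiableAt ℝ (partialDeriv j v) x := fun j =>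
    (hv.partialDeriv j).differentiableAt (by simp)
  rw [partialDeriv_sum _ fun j _ => (h j).fun_pow 2, Finset.mul_sum]
  exact Finset.sum_congr rfl fun j _ => by rw [partialDeriv_sq (h j)]; ring

/-- A refined trace inequality: the quadratic form of `H` in the direction `p` is split off. -/
lemma sq_add_mul_sq_le_sum_sq {n : ℕ} {K A P : ℝ} (hK : 0 ≤ K) (hKn : K * (n - 1) ≤ 1)
    (p : Fin n → ℝ) (H : Fin n → Fin n → ℝ) (hP : 0 < P) (hpP : ∑ i, p i ^ 2 = P)
    (hA : ∑ i, ∑ j, p i * p j * H i j = A * P) :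
    A ^ 2 + K * (∑ i, H i i - A) ^ 2 ≤ ∑ i, ∑ j, H i j ^ 2 := by
  set τ := ∑ i, H i i with hτ
  set B := K * (τ - A) with hB
  set D := (A - B) / P with hD
  have hDP : D * P = A - B := by rw [hD]; field_simp
  have h0 : 0 ≤ ∑ i, ∑ j, (H i j - B * (if i = j then 1 else 0) - D * (p i * p j)) ^ 2 := by
    positivity
  have hpp : ∑ i, ∑ j, (p i * p j) ^ 2 = P ^ 2 := by
    rw [← hpP, pow_two, Finset.sum_mul_sum]
    exact Finset.sum_congr rfl fun i _ => Finset.sum_congr rfl fun j _ => by ring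
  have hexp : ∑ i, ∑ j, (H i j - B * (if i = j then 1 else 0) - D * (p i * p j)) ^ 2
      = ∑ i, ∑ j, H i j ^ 2 + n * B ^ 2 + D ^ 2 * P ^ 2 - 2 * B * τ - 2 * D * (A * P)
        + 2 * B * D * P := by
    have : ∀ i j, (H i j - B * (if i = j then 1 else 0) - D * (p i * p j)) ^ 2
        = H i j ^ 2 + (if i = j then B ^ 2 - 2 * B * H i j + 2 * B * D * (p i * p j) else 0)
          + D ^ 2 * (p i * p j) ^ 2 - 2 * D * (p i * p j * H i j) := fun i j => by
      split_ifs <;> ring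
    simp_rw [this, Finset.sum_sub_distrib, Finset.sum_add_distrib, ← Finset.mul_sum, hpp, hA,
      Finset.sum_ite_eq, Finset.mem_univ, if_true, Finset.sum_add_distrib, Finset.sum_sub_distrib,
      ← Finset.mul_sum, ← pow_two, hpP, ← hτ]
    simp
    ring
  rw [hexp] at h0
  have h1 : D ^ 2 * P ^ 2 = (A - B) ^ 2 := by rw [← hDP]; ring
  have h2 : 2 * D * (A * P) = 2 * A * (A - B) := by rw [← hDP]; ring
  have h3 : 2 * B * D * P = 2 * B * (A - B) := by rw [← hDP]; ring
  rw [h1, h2, h3] at h0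
  have h4 : (n - 1) * B ^ 2 ≤ K * (τ - A) ^ 2 := by
    have : (n - 1) * B ^ 2 = (K * (n - 1)) * (K * (τ - A) ^ 2) := by rw [hB]; ring
    rw [this]
    exact mul_le_of_le_one_left (by positivity) hKn
  have h5 : 2 * B * (τ - A) = 2 * (K * (τ - A) ^ 2) := by rw [hB]; ring
  nlinarith

lemma quadratic_lower_bound {a K P g A c : ℝ} (hK : 0 < K) (ha : 0 < a) (haK : a < 4 * K)
    (hc : c = a * (4 * K - a) / (8 * K)) :
    c * P ^ 2 - (a - 2) ^ 2 / (4 * c) * A ^ 2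
      ≤ A ^ 2 + K * (P + g + A) ^ 2 - 2 * A * P - a * g * P := by
  have hc0 : 0 < c := by rw [hc]; have := sub_pos.2 haK; positivity
  have h1 : A ^ 2 + K * (P + g + A) ^ 2 - 2 * A * P - a * g * P
      - (c * P ^ 2 - (a - 2) ^ 2 / (4 * c) * A ^ 2)
      = A ^ 2 + K * (g + A + (2 * K - a) / (2 * K) * P) ^ 2
        + (c * P + (a - 2) / 2 * A) ^ 2 / c
        + (K - (2 * K - a) ^ 2 / (4 * K) - 2 * c) * P ^ 2 := by
    field_simp
    ring
  have h2 : K - (2 * K - a) ^ 2 / (4 * K) - 2 * c = 0 := by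
    rw [hc]; field_simp; ring
  rw [h2] at h1
  have : 0 ≤ A ^ 2 + K * (g + A + (2 * K - a) / (2 * K) * P) ^ 2
        + (c * P + (a - 2) / 2 * A) ^ 2 / c := by positivity
  linarith

lemma mul_deriv_le_of_antitone {f : ℝ → ℝ} {α t : ℝ} (ht : 0 < t) (hf : DifferentiableAt ℝ f t)
    (hmono : ∀ s t : ℝ, 0 < s → s ≤ t → t ^ (-α) * f t ≤ s ^ (-α) * f s) :
    t * deriv f t ≤ α * f t := by
  have hanti : AntitoneOn (fun s => s ^ (-α) * f s) (Ioi 0) := fun a ha b _ hab =>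
    hmono a b ha hab
  have hd := (Real.hasDerivAt_rpow_const (p := -α) (Or.inl ht.ne')).mul hf.hasDerivAt
  have h := hanti.derivWithin_nonpos (x := t)
  rw [derivWithin_of_isOpen isOpen_Ioi ht] at h
  have h' := hd.deriv
  rw [Pi.mul_def] at h'
  rw [h'] at h
  have hpow : t ^ (-α - 1) * t = t ^ (-α) := by
    rw [← Real.rpow_add_one ht.ne']; ring_nf
  have hpos : 0 < t ^ (-α - 1) := Real.rpow_pos_of_pos ht _
  rw [← hpow] at h
  have : t ^ (-α - 1) * (t * deriv f t - α * f t) ≤ 0 := by linarith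
  linarith [nonpos_of_mul_nonpos_right this hpos]

section Cutoff

variable {n : ℕ} (ρ : ℝ) (x₀ x : E n)

lemma contDiff_sq_sub_norm_sq {k : WithTop ℕ∞} :
    ContDiff ℝ k fun y : E n => ρ ^ 2 + (-1) * ‖y - x₀‖ ^ 2 :=
  contDiff_const.add (contDiff_const.mul ((contDiff_id.sub contDiff_const).norm_sq ℝ))

lemma partialDeriv_sq_sub_norm_sq (i : Fin n) :
    partialDeriv i (fun y => ρ ^ 2 + (-1) * ‖y - x₀‖ ^ 2) x = -2 * (x i - x₀ i) := by
  have h : ContDiff ℝ 1 fun y : E n => ‖y - x₀‖ ^ 2 :=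
    (contDiff_id.sub contDiff_const).norm_sq ℝ
  have hd : DifferentiableAt ℝ (fun y : E n => ‖y - x₀‖ ^ 2) x :=
    h.contDiffAt.differentiableAt (by simp)
  rw [partialDeriv_add (differentiableAt_const _) (hd.const_mul _), partialDeriv_const_mul _ hd,
    partialDeriv_norm_sub_sq]
  simp [partialDeriv]

lemma lap_sq_sub_norm_sq :
    lap (fun y => ρ ^ 2 + (-1) * ‖y - x₀‖ ^ 2) x = -(2 * n) := by
  have h : ContDiffAt ℝ 2 (fun y : E n => ‖y - x₀‖ ^ 2) x :=
    ((contDiff_id.sub contDiff_const).norm_sq ℝ).contDiffAt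
  rw [lap_add contDiffAt_const (contDiffAt_const.mul h), lap_const_mul _ h, lap_norm_sub_sq]
  simp [lap, iteratedFDeriv_two_apply]

lemma partialDeriv_cutoff (i : Fin n) :
    partialDeriv i (fun y => (ρ ^ 2 + (-1) * ‖y - x₀‖ ^ 2) ^ 2) x
      = -4 * (ρ ^ 2 + (-1) * ‖x - x₀‖ ^ 2) * (x i - x₀ i) := by
  rw [partialDeriv_sq ((contDiff_sq_sub_norm_sq (k := 1) ρ x₀).contDiffAt.differentiableAt
    (by simp)), partialDeriv_sq_sub_norm_sq]
  ring

lemma lap_cutoff :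
    lap (fun y => (ρ ^ 2 + (-1) * ‖y - x₀‖ ^ 2) ^ 2) x
      = -(4 * n) * (ρ ^ 2 + (-1) * ‖x - x₀‖ ^ 2) + 8 * ‖x - x₀‖ ^ 2 := by
  rw [lap_sq (contDiff_sq_sub_norm_sq ρ x₀).contDiffAt, lap_sq_sub_norm_sq]
  simp_rw [partialDeriv_sq_sub_norm_sq, mul_pow, ← Finset.mul_sum]
  rw [EuclideanSpace.real_norm_sq_eq]
  simp only [PiLp.sub_apply]
  ring

lemma sum_partialDeriv_cutoff_sq :
    ∑ i, partialDeriv i (fun y => (ρ ^ 2 + (-1) * ‖y - x₀‖ ^ 2) ^ 2) x ^ 2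
      = 16 * (ρ ^ 2 + (-1) * ‖x - x₀‖ ^ 2) ^ 2 * ‖x - x₀‖ ^ 2 := by
  simp_rw [partialDeriv_cutoff, mul_pow, ← Finset.mul_sum]
  rw [EuclideanSpace.real_norm_sq_eq (x - x₀)]
  simp only [PiLp.sub_apply]
  ring

end Cutoff

lemma partialDeriv_log {n : ℕ} {u : E n → ℝ} {x : E n} (hu : DifferentiableAt ℝ u x)
    (hpos : 0 < u x) (i : Fin n) :
    partialDeriv i (fun y => Real.log (u y)) x = (u x)⁻¹ * partialDeriv i u x :=
  partialDeriv_comp (Real.hasDerivAt_log hpos.ne') hu i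

lemma lap_log {n : ℕ} {u : E n → ℝ} {x : E n} (hu : ContDiffAt ℝ 2 u x) (hpos : 0 < u x) :
    lap (fun y => Real.log (u y)) x
      = lap u x / u x - ∑ i, partialDeriv i (fun y => Real.log (u y)) x ^ 2 := by
  have h1 : ∀ᶠ t in 𝓝 (u x), HasDerivAt Real.log (t⁻¹) t :=
    (eventually_ne_nhds hpos.ne').mono fun t ht => Real.hasDerivAt_log ht
  rw [lap_comp (Real.contDiffAt_log.2 hpos.ne') h1 (hasDerivAt_inv hpos.ne') hu]
  simp_rw [partialDeriv_log (hu.differentiableAt (by simp)) hpos, mul_pow, ← Finset.mul_sum]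
  field_simp
  ring

/-- The final algebraic step: `T` is `|D²v|²`, `N` is `|∇η|²`, `S` is `⟨∇η, D²v ∇v⟩`,
and `A` is `D²v` evaluated in the direction of `∇v`. -/
lemma cutoff_mul_le {K a c P g A T Q S N L r η d : ℝ} (hK : 0 < K) (ha : 0 < a)
    (haK : a < 4 * K) (hc : c = a * (4 * K - a) / (8 * K)) (hP : 0 < P) (hη : 0 < η)
    (hT : A ^ 2 + K * (P + g + A) ^ 2 ≤ T) (hQ : -(2 * A * P) - a * g * P ≤ Q)
    (hS : 2 * η * S = -(P * N)) (hA : 4 * η ^ 2 * A ^ 2 ≤ N * P)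
    (hN : N ≤ 16 * r * η) (hL : -(4 * d * r) ≤ L)
    (hB : η * (2 * Q + 2 * T) + P * L + 4 * S ≤ 0) :
    η * P ≤ (8 * ((a - 2) ^ 2 / (4 * c)) + 32 + 4 * d) / (2 * c) * r := by
  have hc0 : 0 < c := by rw [hc]; have := sub_pos.2 haK; positivity
  have hq := quadratic_lower_bound (P := P) (g := g) (A := A) hK ha haK hc
  set C₁ := (a - 2) ^ 2 / (4 * c) with hC₁
  have hC₁0 : 0 ≤ C₁ := by positivity
  have h1 : c * P ^ 2 - C₁ * A ^ 2 ≤ Q + T := by linarith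
  have h2 : η * (2 * (c * P ^ 2 - C₁ * A ^ 2)) + P * L + 4 * S ≤ 0 := by
    have := mul_le_mul_of_nonneg_left h1 hη.le
    linarith
  have hA' : 4 * η ^ 2 * A ^ 2 ≤ 16 * r * η * P :=
    hA.trans (mul_le_mul_of_nonneg_right hN hP.le)
  have hA'' : η * A ^ 2 ≤ 4 * r * P := by
    have : (4 * η) * (η * A ^ 2) ≤ (4 * η) * (4 * r * P) := by linarith
    exact le_of_mul_le_mul_left this (by positivity)
  have hS' : -(8 * r * P) ≤ S := by
    have h3 : P * N ≤ P * (16 * r * η) := mul_le_mul_of_nonneg_left hN hP.le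
    have : (2 * η) * (-(8 * r * P)) ≤ (2 * η) * S := by linarith
    exact le_of_mul_le_mul_left this (by positivity)
  have hPL : P * (-(4 * d * r)) ≤ P * L := mul_le_mul_of_nonneg_left hL hP.le
  have hCA := mul_le_mul_of_nonneg_left hA'' hC₁0
  have h4 : P * (2 * c * (η * P)) ≤ P * ((8 * C₁ + 32 + 4 * d) * r) := by linarith
  have h5 := le_of_mul_le_mul_left h4 hP
  rw [div_mul_eq_mul_div, le_div_iff₀ (by positivity)]
  linarith

lemma cutoff_mul_grad_log_sq_le {n : ℕ} {α K c ρ : ℝ} {f : ℝ → ℝ} {u : E n → ℝ} {x₀ x : E n}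
    (hα : 1 < α) (hK : 0 < K) (hαK : α - 1 < 4 * K) (hKn : K * (n - 1) ≤ 1)
    (hc : c = (α - 1) * (4 * K - (α - 1)) / (8 * K))
    (hf : ContDiffAt ℝ 1 f (u x))
    (hmono : ∀ s t : ℝ, 0 < s → s ≤ t → t ^ (-α) * f t ≤ s ^ (-α) * f s)
    (hu : ContDiffAt ℝ 2 u x) (hpos : 0 < u x) (hpde : ∀ᶠ y in 𝓝 x, lap u y + f (u y) = 0)
    (hx : ‖x - x₀‖ < ρ)
    (hgrad : 0 < ∑ i, partialDeriv i (fun y => Real.log (u y)) x ^ 2)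
    (hmax : IsLocalMax (fun y => (ρ ^ 2 + (-1) * ‖y - x₀‖ ^ 2) ^ 2 *
      ∑ i, partialDeriv i (fun y => Real.log (u y)) y ^ 2) x) :
    (ρ ^ 2 + (-1) * ‖x - x₀‖ ^ 2) ^ 2 * ∑ i, partialDeriv i (fun y => Real.log (u y)) x ^ 2
      ≤ (8 * ((α - 1 - 2) ^ 2 / (4 * c)) + 32 + 4 * n) / (2 * c) * ρ ^ 2 := by
  set v : E n → ℝ := fun y => Real.log (u y) with hvdef
  set η : E n → ℝ := fun y => (ρ ^ 2 + (-1) * ‖y - x₀‖ ^ 2) ^ 2 with hηdef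
  set φ : ℝ → ℝ := fun t => f t / t with hφdef
  have hxρ : ‖x - x₀‖ ^ 2 < ρ ^ 2 := pow_lt_pow_left₀ hx (norm_nonneg _) two_ne_zero
  have hη : 0 < η x := pow_pos (by linarith) 2
  have hηc : ContDiffAt ℝ 2 η x := ((contDiff_sq_sub_norm_sq ρ x₀).pow 2).contDiffAt
  have hv : ContDiffAt ℝ 2 v x := hu.log hpos.ne'
  have hud : DifferentiableAt ℝ u x := hu.differentiableAt (by simp)
  have hfd : DifferentiableAt ℝ f (u x) := hf.differentiableAt (by simp)
  have hφ : HasDerivAt φ ((deriv f (u x) * u x - f (u x)) / u x ^ 2) (u x) := by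
    simpa only [mul_one] using hfd.hasDerivAt.fun_div (hasDerivAt_id' (u x)) hpos.ne'
  have hlapv : lap v =ᶠ[𝓝 x] fun y => (-1) * (∑ i, partialDeriv i v y ^ 2 + φ (u y)) := by
    filter_upwards [hu.eventually (by simp), hu.continuousAt.eventually_const_lt hpos, hpde]
      with y h1 h2 h3
    rw [lap_log h1 h2, eq_neg_of_add_eq_zero_left h3]
    ring
  have hsumc : ContDiffAt ℝ 1 (fun y => ∑ i, partialDeriv i v y ^ 2) x :=
    ContDiffAt.sum fun i _ => (hv.partialDeriv i).pow 2
  have hφc : ContDiffAt ℝ 1 (fun y => φ (u y)) x :=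
    (ContDiffAt.comp x hf (hu.of_le (by norm_num))).div (hu.of_le (by norm_num)) hpos.ne'
  have hlapc : ContDiffAt ℝ 1 (lap v) x :=
    (contDiffAt_const.mul (hsumc.add hφc)).congr_of_eventuallyEq hlapv
  have hbochner := bochner_of_isLocalMax hv hlapc hηc hmax
  set P := ∑ i, partialDeriv i v x ^ 2 with hPdef
  set s : Fin n → ℝ := fun i => ∑ j, partialDeriv j v x * partialDeriv i (partialDeriv j v) x
    with hs
  have hfirst : ∀ i, 2 * η x * s i = -(P * partialDeriv i η x) := fun i => by
    have h := partialDeriv_eq_zero_of_isLocalMax hmax i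
    rw [partialDeriv_mul (hηc.differentiableAt (by simp)) (hsumc.differentiableAt (by simp)),
      partialDeriv_sum_sq hv] at h
    linarith
  set κ := (deriv f (u x) * u x - f (u x)) / u x with hκ
  have hκle : κ ≤ (α - 1) * φ (u x) := by
    have := mul_deriv_le_of_antitone hpos hfd hmono
    rw [hκ, hφdef, ← mul_div_assoc]
    exact div_le_div_of_nonneg_right (by linarith) hpos.le
  have hlapd : ∀ i, partialDeriv i (lap v) x = -(2 * s i) - κ * partialDeriv i v x := fun i => by
    have hd1 := hsumc.differentiableAt (by simp)
    have hd2 := hφc.differentiableAt (by simp)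
    rw [(hlapv.partialDeriv i).eq_of_nhds, partialDeriv_const_mul _ (hd1.fun_add hd2),
      partialDeriv_add hd1 hd2, partialDeriv_sum_sq hv, partialDeriv_comp hφ hud,
      partialDeriv_log hud hpos, hκ]
    field_simp
    ring
  set A := (∑ i, partialDeriv i v x * s i) / P with hAdef
  have hAP : ∑ i, partialDeriv i v x * s i = A * P := by rw [hAdef]; field_simp
  have htrace : ∑ i, partialDeriv i (partialDeriv i v) x = -(P + φ (u x)) := by
    rw [← lap_eq_sum hv, hlapv.eq_of_nhds]
    ring
  refine cutoff_mul_le (g := φ (u x)) (A := A)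
    (T := ∑ i, ∑ j, partialDeriv i (partialDeriv j v) x ^ 2)
    (Q := ∑ i, partialDeriv i v x * partialDeriv i (lap v) x)
    (S := ∑ i, partialDeriv i η x * s i)
    (N := ∑ i, partialDeriv i η x ^ 2) (L := lap η x)
    hK (sub_pos.2 hα) hαK hc hgrad hη ?_ ?_ ?_ ?_ ?_ ?_ ?_
  · have h := sq_add_mul_sq_le_sum_sq hK.le hKn (fun i => partialDeriv i v x)
      (fun i j => partialDeriv i (partialDeriv j v) x) hgrad rfl (A := A) (by
        rw [← hAP]
        simp only [hs, Finset.mul_sum, mul_assoc])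
    simp only [htrace] at h
    linarith
  · have : ∑ i, partialDeriv i v x * partialDeriv i (lap v) x = -(2 * A * P) - κ * P := by
      simp_rw [hlapd]
      calc _ = ∑ i, ((-2) * (partialDeriv i v x * s i) - κ * partialDeriv i v x ^ 2) :=
            Finset.sum_congr rfl fun i _ => by ring
        _ = _ := by
            rw [Finset.sum_sub_distrib, ← Finset.mul_sum, ← Finset.mul_sum, hAP]
            ring
    rw [this]
    linarith [mul_le_mul_of_nonneg_right hκle hgrad.le]
  · rw [Finset.mul_sum, Finset.mul_sum, ← Finset.sum_neg_distrib]
    exact Finset.sum_congr rfl fun i _ => by linear_combination partialDeriv i η x * hfirst i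
  · have h1 : 2 * η x * A = -∑ i, partialDeriv i η x * partialDeriv i v x := by
      have : P * (2 * η x * A) = P * (-∑ i, partialDeriv i η x * partialDeriv i v x) := by
        calc P * (2 * η x * A) = 2 * η x * (A * P) := by ring
          _ = ∑ i, partialDeriv i v x * (2 * η x * s i) := by
              rw [← hAP, Finset.mul_sum]
              exact Finset.sum_congr rfl fun i _ => by ring
          _ = _ := by
              simp_rw [hfirst]
              rw [← Finset.sum_neg_distrib, Finset.mul_sum]
              exact Finset.sum_congr rfl fun i _ => by ring
      exact mul_left_cancel₀ hgrad.ne' this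
    calc 4 * η x ^ 2 * A ^ 2 = (2 * η x * A) ^ 2 := by ring
      _ = (∑ i, partialDeriv i η x * partialDeriv i v x) ^ 2 := by rw [h1, neg_sq]
      _ ≤ _ := Finset.sum_mul_sq_le_sq_mul_sq _ _ _
  · rw [sum_partialDeriv_cutoff_sq]
    nlinarith [mul_le_mul_of_nonneg_left hxρ.le hη.le]
  · rw [lap_cutoff]
    nlinarith [sq_nonneg ‖x - x₀‖, mul_nonneg (Nat.cast_nonneg (α := ℝ) n) (sq_nonneg ‖x - x₀‖)]
  · have h1 : ∑ i, (2 * partialDeriv i v x * partialDeriv i (lap v) x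
        + 2 * ∑ j, partialDeriv i (partialDeriv j v) x ^ 2)
        = 2 * ∑ i, partialDeriv i v x * partialDeriv i (lap v) x
          + 2 * ∑ i, ∑ j, partialDeriv i (partialDeriv j v) x ^ 2 := by
      rw [Finset.sum_add_distrib, Finset.mul_sum, Finset.mul_sum]
      simp only [mul_assoc]
    have h2 : 2 * ∑ j, partialDeriv j η x *
        ∑ i, 2 * partialDeriv i v x * partialDeriv i (partialDeriv j v) x
        = 4 * ∑ j, partialDeriv j η x * s j := by
      simp only [hs, mul_assoc, ← Finset.mul_sum]
      rw [Finset.mul_sum, Finset.mul_sum]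
      refine Finset.sum_congr rfl fun j _ => ?_
      simp only [partialDeriv_comm hv j]
      ring
    rw [h1, h2] at hbochner
    exact hbochner

lemma exists_trace_constant {n : ℕ} (hn : 0 < n) {α : ℝ} (hα : 1 < α)
    (hαp : 1 < n → α < ((n : ℝ) + 3) / ((n : ℝ) - 1)) :
    ∃ K : ℝ, 0 < K ∧ α - 1 < 4 * K ∧ K * (n - 1) ≤ 1 := by
  rcases (Nat.succ_le_of_lt hn).eq_or_lt with h | h
  · exact ⟨α, by linarith, by linarith, by simp [← h]⟩
  · have h1 : (0 : ℝ) < n - 1 := by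
      have : (1 : ℝ) < n := by exact_mod_cast h
      linarith
    refine ⟨1 / (n - 1), by positivity, ?_, by field_simp; rfl⟩
    have := hαp h
    have h2 : ((n : ℝ) + 3) / (n - 1) = 1 + 4 * (1 / (n - 1)) := by field_simp; ring
    linarith

/-- logarithmic gradient estimate for `Δu + f(u) = 0` when `t ↦ t^{-α} f(t)`
is non-increasing on `(0,∞)` for some `α ∈ (1, p(n))`. -/
theorem stmt2 (n : ℕ) (hn : 0 < n) (α : ℝ) (hα : 1 < α)
    (hαp : 1 < n → α < ((n : ℝ) + 3) / ((n : ℝ) - 1)) :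
    ∃ C : ℝ, 0 < C ∧
      ∀ f : ℝ → ℝ, ContDiffOn ℝ 2 f (Ioi 0) →
        (∀ s t : ℝ, 0 < s → s ≤ t → t ^ (-α) * f t ≤ s ^ (-α) * f s) →
        ∀ (x₀ : E n) (R : ℝ), 0 < R →
          ∀ u : E n → ℝ, ContDiffOn ℝ 2 u (ball x₀ (2 * R)) →
            (∀ x ∈ ball x₀ (2 * R), 0 < u x) →
            (∀ x ∈ ball x₀ (2 * R), lap u x + f (u x) = 0) →
            ∀ x ∈ ball x₀ R, ‖gradient u x‖ ^ 2 / (u x) ^ 2 ≤ C / R ^ 2 := by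
  obtain ⟨K, hK, hαK, hKn⟩ := exists_trace_constant hn hα hαp
  obtain ⟨c, hc⟩ : ∃ c, c = (α - 1) * (4 * K - (α - 1)) / (8 * K) := ⟨_, rfl⟩
  have hc0 : 0 < c := by
    have h1 := sub_pos.2 hαK
    have h2 := sub_pos.2 hα
    rw [hc]
    positivity
  obtain ⟨M, hM⟩ : ∃ M, M = (8 * ((α - 1 - 2) ^ 2 / (4 * c)) + 32 + 4 * n) / (2 * c) := ⟨_, rfl⟩
  have hM0 : 0 < M := by rw [hM]; positivity
  refine ⟨2 * M, by positivity, ?_⟩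
  intro f hf hmono x₀ R hR u hu hpos hpde x hx
  set G : E n → ℝ := fun y => ∑ i, partialDeriv i (fun y => Real.log (u y)) y ^ 2 with hG
  set ρ := 3 / 2 * R with hρ
  have hnhds : ∀ y ∈ ball x₀ (2 * R), ball x₀ (2 * R) ∈ 𝓝 y := fun y hy =>
    isOpen_ball.mem_nhds hy
  have huAt : ∀ y ∈ ball x₀ (2 * R), ContDiffAt ℝ 2 u y := fun y hy =>
    hu.contDiffAt (hnhds y hy)
  have hx2 : x ∈ ball x₀ (2 * R) := ball_subset_ball (by linarith) hx
  have hsub : closedBall x₀ ρ ⊆ ball x₀ (2 * R) := closedBall_subset_ball (by linarith)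
  have hxR : ‖x - x₀‖ < R := by rwa [mem_ball, dist_eq_norm] at hx
  have hquot : ‖gradient u x‖ ^ 2 / u x ^ 2 = G x := by
    have hd := (huAt x hx2).differentiableAt (by simp)
    simp only [norm_gradient_sq, hG, partialDeriv_log hd (hpos x hx2), mul_pow, ← Finset.mul_sum]
    rw [inv_pow, div_eq_inv_mul]
  rw [hquot]
  have hG0 : ∀ y, 0 ≤ G y := fun y => Finset.sum_nonneg fun i _ => sq_nonneg _
  rcases (hG0 x).eq_or_lt with hx0 | hxpos
  · rw [← hx0]; positivity
  set F : E n → ℝ := fun y => (ρ ^ 2 + (-1) * ‖y - x₀‖ ^ 2) ^ 2 * G y with hF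
  have hGc : ∀ y ∈ ball x₀ (2 * R), ContinuousAt G y := fun y hy =>
    tendsto_finsetSum _ fun i _ =>
      ((((huAt y hy).log (hpos y hy).ne').partialDeriv i).continuousAt.tendsto.pow 2)
  have hFc : ContinuousOn F (closedBall x₀ ρ) := fun y hy =>
    ((((contDiff_sq_sub_norm_sq (k := 0) ρ x₀).continuous.pow 2).continuousAt).mul
      (hGc y (hsub hy))).continuousWithinAt
  have hxρ : x ∈ closedBall x₀ ρ := by
    rw [mem_closedBall, dist_eq_norm]
    linarith
  obtain ⟨z, hz, hzmax⟩ := (isCompact_closedBall x₀ ρ).exists_isMaxOn ⟨x, hxρ⟩ hFc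
  have hxz : F x ≤ F z := hzmax hxρ
  have hb : 5 / 4 * R ^ 2 ≤ ρ ^ 2 + (-1) * ‖x - x₀‖ ^ 2 := by
    have := pow_le_pow_left₀ (norm_nonneg _) hxR.le 2
    rw [hρ]
    linarith
  have hFx : (5 / 4 * R ^ 2) ^ 2 * G x ≤ F x :=
    mul_le_mul_of_nonneg_right (pow_le_pow_left₀ (by positivity) hb 2) hxpos.le
  have hFz : 0 < F z := lt_of_lt_of_le (by positivity) (hFx.trans hxz)
  have hzρ : ‖z - x₀‖ < ρ := by
    rw [mem_closedBall, dist_eq_norm] at hz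
    refine lt_of_le_of_ne hz fun h => hFz.ne' ?_
    simp [hF, h]
  have hGz : 0 < G z := by
    refine lt_of_le_of_ne (hG0 z) fun h => hFz.ne' ?_
    simp [hF, ← h]
  have hz2 := hsub hz
  have hlocmax : IsLocalMax F z := hzmax.isLocalMax
    (mem_of_superset (isOpen_ball.mem_nhds (by rwa [mem_ball, dist_eq_norm]))
      ball_subset_closedBall)
  have hbound : F z ≤ M * ρ ^ 2 := by
    rw [hM]
    exact cutoff_mul_grad_log_sq_le hα hK hαK hKn hc
      ((hf.contDiffAt (Ioi_mem_nhds (hpos z hz2))).of_le (by norm_num)) hmono (huAt z hz2)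
      (hpos z hz2) (mem_of_superset (hnhds z hz2) hpde) hzρ hGz hlocmax
  rw [le_div_iff₀ (by positivity)]
  have h1 : R ^ 2 * (25 / 16 * (G x * R ^ 2)) ≤ R ^ 2 * (9 / 4 * M) := by
    calc _ = (5 / 4 * R ^ 2) ^ 2 * G x := by ring
      _ ≤ M * ρ ^ 2 := (hFx.trans hxz).trans hbound
      _ = _ := by rw [hρ]; ring
  have h2 := le_of_mul_le_mul_left h1 (by positivity)
  linarith
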